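/- Let X be a Hausdorff topological space. Then |X| ≤ πw(X)^{ot(X)·wψc(X)} (cardinal exponentiation, with product of cardinals in the exponent). -/

import Mathlib

open Set TopologicalSpace Cardinal

universe u

variable (X : Type u) [TopologicalSpace X]

/-- The density `d(X)`: the least infinite cardinal `κ` such that `X` has a dense
subset of cardinality at most `κ`. -/
noncomputable def density : Cardinal.{u} :=
  sInf {κ : Cardinal.{u} | ℵ₀ ≤ κ ∧ ∃ D : Set X, Dense D ∧ #D ≤ κ}

/-- The cellularity `c(X)`: the least infinite cardinal `κ` such that every pairwise
disjoint family of nonempty open subsets of `X` has cardinality at most `κ`. -/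
noncomputable def cellularity : Cardinal.{u} :=
  sInf {κ : Cardinal.{u} | ℵ₀ ≤ κ ∧ ∀ 𝒰 : Set (Set X),
    (∀ U ∈ 𝒰, IsOpen U ∧ U.Nonempty) → (𝒰.Pairwise fun U V => U ∩ V = ∅) → #𝒰 ≤ κ}

/-- The π-character of a point `x`: the least infinite cardinal `κ` such that `x`
has a local π-base of cardinality at most `κ`. -/
noncomputable def piCharAt (x : X) : Cardinal.{u} :=
  sInf {κ : Cardinal.{u} | ℵ₀ ≤ κ ∧ ∃ ℬ : Set (Set X),
    (∀ B ∈ ℬ, IsOpen B ∧ B.Nonempty) ∧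
    (∀ U : Set X, IsOpen U → x ∈ U → ∃ B ∈ ℬ, B ⊆ U) ∧ #ℬ ≤ κ}

/-- The π-character `πχ(X)`: the supremum over `x ∈ X` of `piCharAt X x`. -/
noncomputable def piChar : Cardinal.{u} := ⨆ x : X, piCharAt X x

/-- The π-weight `πw(X)`: the least infinite cardinal `κ` such that `X` has a π-base
of cardinality at most `κ`. -/
noncomputable def piWeight : Cardinal.{u} :=
  sInf {κ : Cardinal.{u} | ℵ₀ ≤ κ ∧ ∃ ℬ : Set (Set X),
    (∀ B ∈ ℬ, IsOpen B ∧ B.Nonempty) ∧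
    (∀ U : Set X, IsOpen U → U.Nonempty → ∃ B ∈ ℬ, B ⊆ U) ∧ #ℬ ≤ κ}

/-- The closed pseudocharacter `ψc(x, X)` of a point `x`: the least infinite cardinal
`κ` such that there is a family `𝒱` of open sets, each containing `x`, with `|𝒱| ≤ κ`
and `{x} = ⋂ 𝒱 = ⋂_{V ∈ 𝒱} cl V`. -/
noncomputable def closedPseudoCharAt (x : X) : Cardinal.{u} :=
  sInf {κ : Cardinal.{u} | ℵ₀ ≤ κ ∧ ∃ 𝒱 : Set (Set X),
    (∀ V ∈ 𝒱, IsOpen V ∧ x ∈ V) ∧ #𝒱 ≤ κ ∧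
    ({x} : Set X) = ⋂₀ 𝒱 ∧ ({x} : Set X) = ⋂ V ∈ 𝒱, closure V}

/-- The dense closed pseudocharacter `dψc(X)`: the least infinite cardinal `κ` such
that `X` has a dense subset `D` with `ψc(d, X) ≤ κ` for every `d ∈ D`. -/
noncomputable def densePsiC : Cardinal.{u} :=
  sInf {κ : Cardinal.{u} | ℵ₀ ≤ κ ∧ ∃ D : Set X, Dense D ∧
    ∀ d ∈ D, closedPseudoCharAt X d ≤ κ}

/-- The weak closed pseudocharacter of a point `x`: the least infinite cardinal `κ`
such that there is a family `𝒱` of open sets (not necessarily containing `x`) with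
`|𝒱| ≤ κ` and `{x} = ⋂_{V ∈ 𝒱} cl V`. -/
noncomputable def weakPsiCAt (x : X) : Cardinal.{u} :=
  sInf {κ : Cardinal.{u} | ℵ₀ ≤ κ ∧ ∃ 𝒱 : Set (Set X),
    (∀ V ∈ 𝒱, IsOpen V) ∧ (({x} : Set X) = ⋂ V ∈ 𝒱, closure V) ∧ #𝒱 ≤ κ}

/-- The weak closed pseudocharacter `wψc(X)`: the supremum over `x ∈ X`. -/
noncomputable def weakPsiC : Cardinal.{u} := ⨆ x : X, weakPsiCAt X x

/-- The q-pseudocharacter of a point `x`: the least infinite cardinal `κ` such that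
`x` has a q-pseudobase of cardinality at most `κ`, i.e. a family `ℬ` of nonempty open
sets such that for every `y ≠ x` there is `𝒞 ⊆ ℬ` with `x ∈ cl (⋃ 𝒞)` and
`y ∉ cl (⋃ 𝒞)`. -/
noncomputable def qPsiAt (x : X) : Cardinal.{u} :=
  sInf {κ : Cardinal.{u} | ℵ₀ ≤ κ ∧ ∃ ℬ : Set (Set X),
    (∀ B ∈ ℬ, IsOpen B ∧ B.Nonempty) ∧ #ℬ ≤ κ ∧
    ∀ y : X, y ≠ x → ∃ 𝒞 ⊆ ℬ, x ∈ closure (⋃₀ 𝒞) ∧ y ∉ closure (⋃₀ 𝒞)}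

/-- The q-pseudocharacter `qψ(X)`: the supremum over `x ∈ X`. -/
noncomputable def qPsi : Cardinal.{u} := ⨆ x : X, qPsiAt X x

/-- The o-tightness `ot(X)`: the least infinite cardinal `κ` such that whenever
`x ∈ cl (⋃ 𝒰)` for a family `𝒰` of open sets, there is `𝒱 ⊆ 𝒰` with `|𝒱| ≤ κ`
and `x ∈ cl (⋃ 𝒱)`. -/
noncomputable def oTightness : Cardinal.{u} :=
  sInf {κ : Cardinal.{u} | ℵ₀ ≤ κ ∧ ∀ (x : X) (𝒰 : Set (Set X)),
    (∀ U ∈ 𝒰, IsOpen U) → x ∈ closure (⋃₀ 𝒰) →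
    ∃ 𝒱 ⊆ 𝒰, #𝒱 ≤ κ ∧ x ∈ closure (⋃₀ 𝒱)}

/-- The dense o-tightness `dot(X)`: the least infinite cardinal `κ` such that whenever
`𝒰` is a family of open sets with `⋃ 𝒰` dense in `X` and `x ∈ X`, there is `𝒱 ⊆ 𝒰`
with `|𝒱| ≤ κ` and `x ∈ cl (⋃ 𝒱)`. -/
noncomputable def denseOTightness : Cardinal.{u} :=
  sInf {κ : Cardinal.{u} | ℵ₀ ≤ κ ∧ ∀ (x : X) (𝒰 : Set (Set X)),
    (∀ U ∈ 𝒰, IsOpen U) → Dense (⋃₀ 𝒰) →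
    ∃ 𝒱 ⊆ 𝒰, #𝒱 ≤ κ ∧ x ∈ closure (⋃₀ 𝒱)}

/-- A space is quasiregular if every nonempty open set contains the closure of some
nonempty open set. -/
def QuasiRegular : Prop :=
  ∀ U : Set X, IsOpen U → U.Nonempty → ∃ V : Set X, IsOpen V ∧ V.Nonempty ∧ closure V ⊆ U

/-- The collection `RO(X)` of regular open subsets of `X`. -/
def regularOpens : Set (Set X) := {U : Set X | U = interior (closure U)}

theorem aux_enum {α : Type u} (S : Set α) (hS : S.Nonempty) (κ : Cardinal.{u}) (h : #S ≤ κ) :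
    ∃ f : κ.out → α, Set.range f = S := by
  have h' : #S ≤ #κ.out := by simpa using h
  obtain ⟨e⟩ := h'
  haveI : Nonempty S := hS.to_subtype
  refine ⟨fun i => (Function.invFun e i : S), ?_⟩
  have hs := Function.invFun_surjective e.injective
  ext y
  constructor
  · rintro ⟨i, rfl⟩
    exact Subtype.coe_prop _
  · intro hy
    obtain ⟨i, hi⟩ := hs ⟨y, hy⟩
    exact ⟨i, by simp [hi]⟩

theorem aux_pi (X : Type u) [TopologicalSpace X] : ∃ ℬ : Set (Set X),
    (∀ B ∈ ℬ, IsOpen B ∧ B.Nonempty) ∧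
    (∀ U : Set X, IsOpen U → U.Nonempty → ∃ B ∈ ℬ, B ⊆ U) ∧ #ℬ ≤ piWeight X := by
  have := csInf_mem (s := {κ : Cardinal.{u} | ℵ₀ ≤ κ ∧ ∃ ℬ : Set (Set X),
    (∀ B ∈ ℬ, IsOpen B ∧ B.Nonempty) ∧
    (∀ U : Set X, IsOpen U → U.Nonempty → ∃ B ∈ ℬ, B ⊆ U) ∧ #ℬ ≤ κ})
    ⟨max ℵ₀ #(Set X), le_max_left _ _, {B | IsOpen B ∧ B.Nonempty}, fun B h => h,
      fun U h1 h2 => ⟨U, ⟨h1, h2⟩, subset_rfl⟩, (mk_set_le _).trans (le_max_right _ _)⟩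
  exact this.2

theorem aux_ot (X : Type u) [TopologicalSpace X] : ∀ (x : X) (𝒰 : Set (Set X)),
    (∀ U ∈ 𝒰, IsOpen U) → x ∈ closure (⋃₀ 𝒰) →
    ∃ 𝒱 ⊆ 𝒰, #𝒱 ≤ oTightness X ∧ x ∈ closure (⋃₀ 𝒱) := by
  have := csInf_mem (s := {κ : Cardinal.{u} | ℵ₀ ≤ κ ∧ ∀ (x : X) (𝒰 : Set (Set X)),
    (∀ U ∈ 𝒰, IsOpen U) → x ∈ closure (⋃₀ 𝒰) →
    ∃ 𝒱 ⊆ 𝒰, #𝒱 ≤ κ ∧ x ∈ closure (⋃₀ 𝒱)})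
    ⟨max ℵ₀ #(Set X), le_max_left _ _, fun x 𝒰 _ h => ⟨𝒰, subset_rfl,
      (mk_set_le _).trans (le_max_right _ _), h⟩⟩
  exact this.2

theorem aux_w (X : Type u) [TopologicalSpace X] [T2Space X] (x : X) :
    ℵ₀ ≤ weakPsiC X ∧ ∃ 𝒱 : Set (Set X),
    (∀ V ∈ 𝒱, IsOpen V) ∧ (({x} : Set X) = ⋂ V ∈ 𝒱, closure V) ∧ #𝒱 ≤ weakPsiC X := by
  have := csInf_mem (s := {κ : Cardinal.{u} | ℵ₀ ≤ κ ∧ ∃ 𝒱 : Set (Set X),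
    (∀ V ∈ 𝒱, IsOpen V) ∧ (({x} : Set X) = ⋂ V ∈ 𝒱, closure V) ∧ #𝒱 ≤ κ})
    ⟨max ℵ₀ #(Set X), le_max_left _ _, {V | IsOpen V ∧ x ∈ V}, fun V h => h.1, by
      ext y
      simp only [mem_singleton_iff, mem_iInter, mem_setOf_eq]
      constructor
      · rintro rfl V hV
        exact subset_closure hV.2
      · intro h
        by_contra hne
        obtain ⟨A, B, hA, hB, hyA, hxB, hd⟩ := t2_separation hne
        obtain ⟨z, hz⟩ := mem_closure_iff.1 (h B ⟨hB, hxB⟩) A hA hyA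
        exact Set.disjoint_left.1 hd hz.1 hz.2, (mk_set_le _).trans (le_max_right _ _)⟩
  have hle : weakPsiCAt X x ≤ weakPsiC X :=
    le_ciSup (f := fun x => weakPsiCAt X x) (Cardinal.bddAbove_range _) x
  obtain ⟨h0, 𝒱, h1, h2, h3⟩ := this
  exact ⟨h0.trans hle, 𝒱, h1, h2, h3.trans hle⟩

theorem aux_w' (X : Type u) [TopologicalSpace X] [T2Space X] (x : X) :
    ∃ f : (weakPsiC X).out → Set X, (∀ i, IsOpen (f i)) ∧ ({x} : Set X) = ⋂ i, closure (f i) := by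
  obtain ⟨h0, 𝒱, h1, h2, h3⟩ := aux_w X x
  rcases 𝒱.eq_empty_or_nonempty with rfl | hne
  · exact ⟨fun _ => univ, fun _ => isOpen_univ, by simpa using h2⟩
  · obtain ⟨f, hf⟩ := aux_enum 𝒱 hne _ h3
    refine ⟨f, fun i => h1 _ (hf ▸ mem_range_self i), ?_⟩
    rw [h2, ← hf, biInter_range]

theorem stmt_18 (X : Type u) [TopologicalSpace X] [T2Space X] :
    #X ≤ piWeight X ^ (oTightness X * weakPsiC X) := by
  rcases isEmpty_or_nonempty X with hX | hX
  · simp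
  obtain ⟨ℬ, hB1, hB2, hB3⟩ := aux_pi X
  have hBne : ℬ.Nonempty := by
    obtain ⟨B, hB, _⟩ := hB2 univ isOpen_univ univ_nonempty
    exact ⟨B, hB⟩
  obtain ⟨g, hg⟩ := aux_enum ℬ hBne _ hB3
  have key : ∀ x : X, ∃ F : (oTightness X).out × (weakPsiC X).out → (piWeight X).out,
      ({x} : Set X) = ⋂ i, closure (⋃ t, g (F (t, i))) := by
    intro x
    obtain ⟨f, hf1, hf2⟩ := aux_w' X x
    have hi : ∀ i, ∃ h : (oTightness X).out → (piWeight X).out,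
        x ∈ closure (⋃ t, g (h t)) ∧ (⋃ t, g (h t)) ⊆ f i := by
      intro i
      have hxi : x ∈ closure (f i) := by
        have : x ∈ ⋂ i, closure (f i) := hf2 ▸ mem_singleton x
        exact mem_iInter.1 this i
      have hx : x ∈ closure (⋃₀ {B | B ∈ ℬ ∧ B ⊆ f i}) := by
        rw [mem_closure_iff]
        intro O hO hxO
        have hne := mem_closure_iff.1 hxi O hO hxO
        obtain ⟨B, hB, hBs⟩ := hB2 _ (hO.inter (hf1 i)) hne
        obtain ⟨z, hz⟩ := (hB1 B hB).2
        exact ⟨z, (hBs hz).1, B, ⟨hB, fun w hw => (hBs hw).2⟩, hz⟩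
      obtain ⟨𝒲, hW1, hW2, hW3⟩ := aux_ot X x _ (fun U hU => (hB1 U hU.1).1) hx
      have hWne : 𝒲.Nonempty := by
        rcases 𝒲.eq_empty_or_nonempty with rfl | h
        · simp at hW3
        · exact h
      obtain ⟨k, hk⟩ := aux_enum 𝒲 hWne _ hW2
      have hkm : ∀ t, k t ∈ 𝒲 := fun t => hk ▸ mem_range_self t
      have : ∀ t, ∃ p, g p = k t := fun t => by
        have : k t ∈ Set.range g := hg ▸ (hW1 (hkm t)).1
        exact this
      choose h hh using this
      refine ⟨h, ?_, ?_⟩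
      · simp only [hh]
        rwa [← sUnion_range, hk]
      · simp only [hh]
        exact iUnion_subset fun t => (hW1 (hkm t)).2
    choose h hh1 hh2 using hi
    refine ⟨fun p => h p.2 p.1, ?_⟩
    apply subset_antisymm
    · rintro _ rfl
      exact mem_iInter.2 hh1
    · rw [hf2]
      exact iInter_mono fun i => closure_mono (hh2 i)
  choose F hF using key
  have hinj : Function.Injective F := by
    intro x y hxy
    have := (hF x).trans (hxy ▸ (hF y).symm)
    exact singleton_injective this
  have := mk_le_of_injective hinj
  simpa [mk_prod] using this
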